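/- Let x be an irrational real number, k ≥ 2 an integer, and A a Γ-equivalence class in 𝒬 (Γ = PGL₂(ℤ)). Then A_{k,A}(x) := Σ_{Q ∈ A⟨x⟩} Q(x)^{k−1} equals Σ_{Q ∈ A^Sim} Σ_{γ ∈ Γ(x), Q(⌊γ(x)⌋) > 0, Q(γ(∞)) < 0} (Q|γ)(x)^{k−1}, and also equals Σ_{Q ∈ A^Red} Σ_{γ ∈ Γ(x)′, Q(γ(∞)) < 0} (Q|γ)(x)^{k−1}. -/

import Mathlib

open Polynomial Matrix

noncomputable section

abbrev Mat2 := Matrix (Fin 2) (Fin 2) ℤ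

/-- The matrix `Tⁿ = [[1,n],[0,1]]`. -/
def Tpow (n : ℤ) : Mat2 := !![1, n; 0, 1]

/-- The matrix `ε = [[0,1],[1,0]]`. -/
def Meps : Mat2 := !![0, 1; 1, 0]

/-- The matrix `S = [[0,-1],[1,0]]`. -/
def MS : Mat2 := !![0, -1; 1, 0]

/-- The matrix `T = [[1,1],[0,1]]`. -/
def MT : Mat2 := !![1, 1; 0, 1]

/-- The matrix `σ = [[-1,0],[0,1]]`. -/
def Msig : Mat2 := !![-1, 0; 0, 1]

/-- The matrix `U = TS = [[1,-1],[1,0]]`. -/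
def MU : Mat2 := MT * MS

/-- Möbius action of an integer matrix on a real number. -/
def moeb (M : Mat2) (x : ℝ) : ℝ :=
  ((M 0 0 : ℝ) * x + (M 0 1 : ℝ)) / ((M 1 0 : ℝ) * x + (M 1 1 : ℝ))

/-- The sequence `x_i` of the (positive) continued fraction algorithm:
`x_0 = x`, `x_{i+1} = 1/(x_i - ⌊x_i⌋)`. -/
def cfX (x : ℝ) : ℕ → ℝ
  | 0 => x
  | i + 1 => 1 / (cfX x i - (⌊cfX x i⌋ : ℝ))

/-- The partial quotients `n_i = ⌊x_i⌋` of the continued fraction of `x`. -/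
def cfN (x : ℝ) (i : ℕ) : ℤ := ⌊cfX x i⌋

/-- The matrices `γ_0 = Id`, `γ_{i+1} = ε T^{-n_i} γ_i`. -/
def gam (x : ℝ) : ℕ → Mat2
  | 0 => 1
  | i + 1 => (Meps * Tpow (-(cfN x i))) * gam x i

/-- `Γ(x) = {γ_1, γ_2, γ_3, …}`. -/
def GammaSet (x : ℝ) : Set Mat2 := {M | ∃ i, 1 ≤ i ∧ M = gam x i}

/-- The matrices `γ'_0 = Id`, `γ'_{i+1} = Tγ'_i` if `γ'_i(x) ≤ 0`,
`T^{-1}εγ'_i` if `0 < γ'_i(x) ≤ 1`, and `T^{-1}γ'_i` if `γ'_i(x) > 1`. -/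
def gam' (x : ℝ) : ℕ → Mat2
  | 0 => 1
  | i + 1 =>
    if moeb (gam' x i) x ≤ 0 then MT * gam' x i
    else if moeb (gam' x i) x ≤ 1 then (Tpow (-1) * Meps) * gam' x i
    else Tpow (-1) * gam' x i

/-- `Γ(x)' = {γ'_1, γ'_2, γ'_3, …}`. -/
def GammaSet' (x : ℝ) : Set Mat2 := {M | ∃ i, 1 ≤ i ∧ M = gam' x i}

/-- The sequence `x_i` of the negative continued fraction algorithm:
`x_0 = x`, `x_{i+1} = 1/(⌈x_i⌉ - x_i)`. -/
def ncfX (x : ℝ) : ℕ → ℝ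
  | 0 => x
  | i + 1 => 1 / ((⌈ncfX x i⌉ : ℝ) - ncfX x i)

/-- The partial quotients `m_i = ⌈x_i⌉` of the negative continued fraction of `x`. -/
def ncfM (x : ℝ) (i : ℕ) : ℤ := ⌈ncfX x i⌉

/-- The matrices `γ̃_0 = Id`, `γ̃_{i+1} = S T^{-m_i} γ̃_i`. -/
def gamt (x : ℝ) : ℕ → Mat2
  | 0 => 1
  | i + 1 => (MS * Tpow (-(ncfM x i))) * gamt x i

/-- `Γ₁(x) = {γ̃_1, γ̃_2, γ̃_3, …}`. -/
def Gamma1Set (x : ℝ) : Set Mat2 := {M | ∃ i, 1 ≤ i ∧ M = gamt x i}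

/-- A binary quadratic polynomial `aX² + bX + c`, encoded as the triple `(a,b,c)`. -/
abbrev QF := ℤ × ℤ × ℤ

/-- The value of `aX² + bX + c` at a real number `x`. -/
def Qval (q : QF) (x : ℝ) : ℝ := (q.1 : ℝ) * x ^ 2 + (q.2.1 : ℝ) * x + (q.2.2 : ℝ)

/-- The value of `aX² + bX + c` at an integer `m`. -/
def QvalZ (q : QF) (m : ℤ) : ℤ := q.1 * m ^ 2 + q.2.1 * m + q.2.2

/-- The discriminant `b² - 4ac`. -/
def Qdisc (q : QF) : ℤ := q.2.1 ^ 2 - 4 * q.1 * q.2.2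

/-- The homogenized value `a r² + b r t + c t²`; for `t ≠ 0` its sign is that of `Q(r/t)`,
and for `t = 0` that of the leading coefficient, i.e. of `Q(∞)`. -/
def Qhom (q : QF) (r t : ℤ) : ℤ := q.1 * r ^ 2 + q.2.1 * r * t + q.2.2 * t ^ 2

/-- The weight 2 action `(Q|γ)(X) = (tX+u)² Q((rX+s)/(tX+u))` on quadratic polynomials,
for `γ = [[r,s],[t,u]]`. -/
def qslash (M : Mat2) (q : QF) : QF :=
  (Qhom q (M 0 0) (M 1 0),
   2 * q.1 * M 0 0 * M 0 1 + q.2.1 * (M 0 0 * M 1 1 + M 0 1 * M 1 0) + 2 * q.2.2 * M 1 0 * M 1 1,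
   Qhom q (M 0 1) (M 1 1))

/-- The set `𝒬` of integral quadratic polynomials with positive non-square discriminant. -/
def Qset : Set QF := {q | 0 < Qdisc q ∧ ¬ IsSquare (Qdisc q)}

/-- `A` is a `Γ`-equivalence class in `𝒬`, where `Γ = PGL₂(ℤ)`. -/
def IsClassQ (A : Set QF) : Prop :=
  ∃ q₀ ∈ Qset, A = {q ∈ Qset | ∃ M : Mat2, IsUnit M.det ∧ q = qslash M q₀}

/-- `B` is a `Γ₁`-equivalence class in `𝒬`, where `Γ₁ = PSL₂(ℤ)`. -/
def IsClassQ1 (B : Set QF) : Prop :=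
  ∃ q₀ ∈ Qset, B = {q ∈ Qset | ∃ M : Mat2, M.det = 1 ∧ q = qslash M q₀}

/-- `A^Sim = {Q ∈ A : Q(0) < 0 < Q(∞)}`. -/
def QSim (A : Set QF) : Set QF := {q ∈ A | q.2.2 < 0 ∧ 0 < q.1}

/-- `A^Red = {Q ∈ A : Q(∞) > 0, Q(-1) < 0 < Q(0)}`. -/
def QRed (A : Set QF) : Set QF := {q ∈ A | 0 < q.1 ∧ q.1 - q.2.1 + q.2.2 < 0 ∧ 0 < q.2.2}

/-- `A⟨x⟩ = {Q ∈ A : Q(∞) < 0 < Q(x)}`. -/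
def QxSet (A : Set QF) (x : ℝ) : Set QF := {q ∈ A | q.1 < 0 ∧ 0 < Qval q x}

/-- `𝒬_D⟨x⟩`, the set of quadratics of discriminant `D` with `Q(∞) < 0 < Q(x)`. -/
def QDx (D : ℕ) (x : ℝ) : Set QF :=
  {q | Qdisc q = (D : ℤ) ∧ q.1 < 0 ∧ 0 < Qval q x}

/-- The simple forms of discriminant `D`: `a > 0 > c`. -/
def SimpleD (D : ℕ) : Set QF := {q | Qdisc q = (D : ℤ) ∧ 0 < q.1 ∧ q.2.2 < 0}

/-- The reduced forms of discriminant `D`: `a > 0`, `c > 0`, `b > a + c`. -/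
def ReducedD (D : ℕ) : Set QF :=
  {q | Qdisc q = (D : ℤ) ∧ 0 < q.1 ∧ 0 < q.2.2 ∧ q.1 + q.2.2 < q.2.1}

/-- Homogenized evaluation of a polynomial of degree ≤ d: `∑ P_j r^j t^{d-j}`;
for `t ≠ 0` its sign is that of `P(r/t)` (`d` even), and for `t = 0` that of `P(∞)`. -/
def homEval (d : ℕ) (P : Polynomial ℤ) (r t : ℤ) : ℤ :=
  ∑ j ∈ Finset.range (d + 1), P.coeff j * r ^ j * t ^ (d - j)

/-- The weight `d` action `(P|γ)(X) = (tX+u)^d P((rX+s)/(tX+u))` on integral polynomials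
of degree at most `d`, for `γ = [[r,s],[t,u]]`. -/
def pslash (d : ℕ) (M : Mat2) (P : Polynomial ℤ) : Polynomial ℤ :=
  ∑ j ∈ Finset.range (d + 1),
    C (P.coeff j) * (C (M 0 0) * X + C (M 0 1)) ^ j * (C (M 1 0) * X + C (M 1 1)) ^ (d - j)

/-- `P` has exactly two real roots `w ≠ w'`, both irrational. -/
def HasTwoIrratRoots (P : Polynomial ℤ) (w w' : ℝ) : Prop :=
  w ≠ w' ∧ Irrational w ∧ Irrational w' ∧ ∀ y : ℝ, Polynomial.aeval y P = 0 ↔ y = w ∨ y = w'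

/-- `F_d`: integral polynomials of degree ≤ d with exactly two real roots, both irrational. -/
def Fd (d : ℕ) : Set (Polynomial ℤ) :=
  {P | P.natDegree ≤ d ∧ ∃ w w' : ℝ, HasTwoIrratRoots P w w'}

/-- `A` is a `Γ`-equivalence class in `F_d`, where `Γ = PGL₂(ℤ)`. -/
def IsClassF (d : ℕ) (A : Set (Polynomial ℤ)) : Prop :=
  ∃ P₀ ∈ Fd d, A = {P ∈ Fd d | ∃ M : Mat2, IsUnit M.det ∧ P = pslash d M P₀}

/-- `B` is a `Γ₁`-equivalence class in `F_d`, where `Γ₁ = PSL₂(ℤ)`. -/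
def IsClassF1 (d : ℕ) (B : Set (Polynomial ℤ)) : Prop :=
  ∃ P₀ ∈ Fd d, B = {P ∈ Fd d | ∃ M : Mat2, M.det = 1 ∧ P = pslash d M P₀}

/-- `A^Sim = {P ∈ A : P(0) < 0 < P(∞)}`, where `P(∞)` is the coefficient of `X^d`. -/
def PSim (d : ℕ) (A : Set (Polynomial ℤ)) : Set (Polynomial ℤ) :=
  {P ∈ A | P.coeff 0 < 0 ∧ 0 < P.coeff d}

/-- `A^Red = {P ∈ A : P(∞) > 0 and P(-1) < 0 < P(0)}`. -/
def PRed (d : ℕ) (A : Set (Polynomial ℤ)) : Set (Polynomial ℤ) :=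
  {P ∈ A | 0 < P.coeff d ∧ Polynomial.aeval (-1 : ℤ) P < 0 ∧ 0 < P.coeff 0}

/-- `A⟨x⟩ = {P ∈ A : P(∞) < 0 < P(x)}`. -/
def Px (d : ℕ) (A : Set (Polynomial ℤ)) (x : ℝ) : Set (Polynomial ℤ) :=
  {P ∈ A | P.coeff d < 0 ∧ 0 < Polynomial.aeval x P}

/-- The numerators of the convergents, shifted by 2: `pconv x i = p_{i-2}`. -/
def pconv (x : ℝ) : ℕ → ℤ
  | 0 => 0
  | 1 => 1
  | i + 2 => cfN x i * pconv x (i + 1) + pconv x i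

/-- The denominators of the convergents, shifted by 2: `qconv x i = q_{i-2}`. -/
def qconv (x : ℝ) : ℕ → ℤ
  | 0 => 1
  | 1 => 0
  | i + 2 => cfN x i * qconv x (i + 1) + qconv x i

/-- `δ_i = (-1)^i (p_{i-1} - q_{i-1} x)` for `i ≥ 0`. -/
def cfDelta (x : ℝ) (i : ℕ) : ℝ :=
  (-1 : ℝ) ^ i * ((pconv x (i + 1) : ℝ) - (qconv x (i + 1) : ℝ) * x)

/-- The weight `d` action `(P|γ)(X) = (tX+u)^d P((rX+s)/(tX+u))` on complex polynomials
of degree at most `d`, for `γ = [[r,s],[t,u]]` with integer entries. -/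
def cslash (d : ℕ) (M : Mat2) (P : Polynomial ℂ) : Polynomial ℂ :=
  ∑ j ∈ Finset.range (d + 1),
    C (P.coeff j) * (C (M 0 0 : ℂ) * X + C (M 0 1 : ℂ)) ^ j *
      (C (M 1 0 : ℂ) * X + C (M 1 1 : ℂ)) ^ (d - j)

/-- `P^Γ(x) = ∑_{γ ∈ Γ(x)} (P|γ)(x)` for `P` of degree ≤ 2k. -/
def PGam (k : ℕ) (P : Polynomial ℂ) (x : ℝ) : ℂ :=
  ∑' γ : GammaSet x, Polynomial.eval (x : ℂ) (cslash (2 * k) γ.1 P)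

/-- Pairs `(Q,γ) ∈ A^Sim × Γ(x)` with `Q(⌊γ(x)⌋) > 0` and `Q(γ(∞)) < 0`. -/
def SimPairs (A : Set QF) (x : ℝ) : Set (QF × Mat2) :=
  {pg | pg.1 ∈ QSim A ∧ pg.2 ∈ GammaSet x ∧
    0 < QvalZ pg.1 ⌊moeb pg.2 x⌋ ∧ Qhom pg.1 (pg.2 0 0) (pg.2 1 0) < 0}

/-- Pairs `(Q,γ) ∈ A^Red × Γ(x)'` with `Q(γ(∞)) < 0`. -/
def RedPairs (A : Set QF) (x : ℝ) : Set (QF × Mat2) :=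
  {pg | pg.1 ∈ QRed A ∧ pg.2 ∈ GammaSet' x ∧ Qhom pg.1 (pg.2 0 0) (pg.2 1 0) < 0}

/-- The linear form `rX + s` attached to the top row of a matrix, evaluated at `x`. -/
def topForm (M : Mat2) (x : ℝ) : ℝ := (M 0 0 : ℝ) * x + (M 0 1 : ℝ)

/-- The linear form `tX + u` attached to the bottom row of a matrix, evaluated at `x`. -/
def botForm (M : Mat2) (x : ℝ) : ℝ := (M 1 0 : ℝ) * x + (M 1 1 : ℝ)

lemma moeb_eq_div (M : Mat2) (x : ℝ) : moeb M x = topForm M x / botForm M x := rfl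

lemma Qval_qslash (M : Mat2) (q : QF) (x : ℝ) :
    Qval (qslash M q) x = q.1 * topForm M x ^ 2 + q.2.1 * topForm M x * botForm M x
      + q.2.2 * botForm M x ^ 2 := by
  simp only [Qval, qslash, Qhom, topForm, botForm]
  push_cast
  ring

lemma qslash_qslash (M N : Mat2) (q : QF) : qslash M (qslash N q) = qslash (N * M) q := by
  simp only [qslash, Qhom, Matrix.mul_apply, Fin.sum_univ_two, Prod.mk.injEq]
  refine ⟨?_, ?_, ?_⟩ <;> ring

lemma qslash_smul_one {n : ℤ} (hn : IsUnit n) (q : QF) : qslash (n • (1 : Mat2)) q = q := by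
  obtain rfl | rfl := Int.isUnit_iff.mp hn <;> simp [qslash, Qhom]

lemma qslash_qslash_adjugate {M : Mat2} (hM : IsUnit M.det) (q : QF) :
    qslash M (qslash M.adjugate q) = q := by
  rw [qslash_qslash, Matrix.adjugate_mul, qslash_smul_one hM]

lemma qslash_adjugate_qslash {M : Mat2} (hM : IsUnit M.det) (q : QF) :
    qslash M.adjugate (qslash M q) = q := by
  rw [qslash_qslash, Matrix.mul_adjugate, qslash_smul_one hM]

lemma qslash_adjugate_fst (M : Mat2) (q : QF) :
    (qslash M.adjugate q).1 = Qhom q (M 1 1) (-M 1 0) := by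
  simp [qslash, Matrix.adjugate_fin_two]

lemma qslash_adjugate_snd_snd (M : Mat2) (q : QF) :
    (qslash M.adjugate q).2.2 = Qhom q (M 0 1) (-M 0 0) := by
  simp [qslash, Qhom, Matrix.adjugate_fin_two]

lemma isUnit_det_adjugate {M : Mat2} (hM : IsUnit M.det) : IsUnit M.adjugate.det := by
  simpa [Matrix.det_adjugate] using hM

lemma Qdisc_qslash {M : Mat2} (hM : IsUnit M.det) (q : QF) : Qdisc (qslash M q) = Qdisc q := by
  have h : Qdisc (qslash M q) = M.det * M.det * Qdisc q := by
    simp only [Qdisc, qslash, Qhom, Matrix.det_fin_two]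
    ring
  rw [h, Int.isUnit_mul_self hM, one_mul]

lemma IsClassQ.subset {A : Set QF} (hA : IsClassQ A) : A ⊆ Qset := by
  obtain ⟨q₀, -, rfl⟩ := hA
  exact fun q hq => hq.1

lemma IsClassQ.qslash_mem {A : Set QF} (hA : IsClassQ A) {M : Mat2} (hM : IsUnit M.det)
    {q : QF} (hq : q ∈ A) : qslash M q ∈ A := by
  obtain ⟨q₀, -, rfl⟩ := hA
  obtain ⟨hq, N, hN, rfl⟩ := hq
  refine ⟨?_, N * M, ?_, qslash_qslash _ _ _⟩
  · exact ⟨by simpa only [Qdisc_qslash hM] using hq.1, by simpa only [Qdisc_qslash hM] using hq.2⟩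
  · rw [Matrix.det_mul]
    exact hN.mul hM

lemma fst_ne_zero_of_mem_Qset {q : QF} (hq : q ∈ Qset) : q.1 ≠ 0 := fun h =>
  hq.2 ⟨q.2.1, by simp only [Qdisc, h]; ring⟩

lemma snd_snd_ne_zero_of_mem_Qset {q : QF} (hq : q ∈ Qset) : q.2.2 ≠ 0 := fun h =>
  hq.2 ⟨q.2.1, by simp only [Qdisc, h]; ring⟩

lemma IsClassQ.finite_QSim {A : Set QF} (hA : IsClassQ A) : (QSim A).Finite := by
  obtain ⟨q₀, -, rfl⟩ := hA
  set D := Qdisc q₀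
  refine (Set.finite_Icc ((-D, -D, -D) : QF) (D, D, D)).subset ?_
  rintro q ⟨⟨-, M, hM, hq⟩, hc, ha⟩
  have hD : q.2.1 ^ 2 - 4 * q.1 * q.2.2 = D := by
    rw [hq]
    exact Qdisc_qslash hM q₀
  simp only [Set.mem_Icc, Prod.le_def]
  have hb : q.2.1 ≤ q.2.1 ^ 2 ∧ -q.2.1 ≤ q.2.1 ^ 2 :=
    ⟨Int.le_self_sq _, by simpa using Int.le_self_sq (-q.2.1)⟩
  have h1 := mul_nonneg (show 0 ≤ q.1 - 1 by omega) (show 0 ≤ -q.2.2 - 1 by omega)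
  refine ⟨⟨?_, ?_, ?_⟩, ?_, ?_, ?_⟩ <;> nlinarith [sq_nonneg q.2.1]

lemma linear_form_ne_zero {x : ℝ} (hx : Irrational x) {r s : ℤ} (h : r ≠ 0 ∨ s ≠ 0) :
    (r : ℝ) * x + s ≠ 0 := by
  rcases eq_or_ne r 0 with rfl | hr
  · simpa using h
  · exact ((hx.intCast_mul hr).add_intCast s).ne_zero

lemma topForm_ne_zero {x : ℝ} (hx : Irrational x) {M : Mat2} (hM : IsUnit M.det) :
    topForm M x ≠ 0 := by
  refine linear_form_ne_zero hx ?_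
  by_contra! h
  simp [Matrix.det_fin_two, h.1, h.2] at hM

lemma botForm_ne_zero {x : ℝ} (hx : Irrational x) {M : Mat2} (hM : IsUnit M.det) :
    botForm M x ≠ 0 := by
  refine linear_form_ne_zero hx ?_
  by_contra! h
  simp [Matrix.det_fin_two, h.1, h.2] at hM

/-- If `Q(x) > 0`, then `Q` is positive at all fractions `-u/t` for which `tx + u` is small. -/
lemma exists_Qhom_pos_of_small {q : QF} {x : ℝ} (hq : 0 < Qval q x) :
    ∃ e > 0, ∀ t u : ℤ, (t : ℝ) * x + u ≠ 0 → |(t : ℝ) * x + u| < e →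
      0 < Qhom q u (-t) := by
  set B : ℝ := |2 * q.1 * x + q.2.1| with hB
  set C : ℝ := |(q.1 : ℝ)| with hC
  have hden : 0 < B + C + 1 := by positivity
  refine ⟨min 1 (Qval q x / (B + C + 1)), by positivity, fun t u hne hlt => ?_⟩
  obtain ⟨h1, h2⟩ := lt_min_iff.mp hlt
  rw [lt_div_iff₀ hden] at h2
  have ht : t ≠ 0 := by
    rintro rfl
    simp only [Int.cast_zero, zero_mul, zero_add] at h1 hne
    have : |u| < 1 := by exact_mod_cast h1
    exact hne (by exact_mod_cast Int.abs_lt_one_iff.mp this)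
  have ht1 : (1 : ℝ) ≤ |(t : ℝ)| := by exact_mod_cast Int.one_le_abs ht
  have key : ((Qhom q u (-t) : ℤ) : ℝ) = Qval q x * |(t : ℝ)| ^ 2
      - (t * x + u) * t * (2 * q.1 * x + q.2.1) + q.1 * (t * x + u) ^ 2 := by
    simp only [Qhom, Qval, sq_abs]
    push_cast
    ring
  set L : ℝ := t * x + u
  have e1 : L * t * (2 * q.1 * x + q.2.1) ≤ |L| * |(t : ℝ)| * B := by
    rw [hB, ← abs_mul, ← abs_mul]
    exact le_abs_self _
  have e2 : -(C * |L| ^ 2) ≤ q.1 * L ^ 2 := by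
    have := neg_abs_le ((q.1 : ℝ) * L ^ 2)
    rwa [abs_mul, abs_pow] at this
  have hL := abs_nonneg L
  have hB0 : 0 ≤ B := abs_nonneg _
  have hC0 : 0 ≤ C := abs_nonneg _
  have e3 : |L| * |(t : ℝ)| * B ≤ |L| * B * |(t : ℝ)| ^ 2 := by
    nlinarith [mul_nonneg (mul_nonneg hL hB0) (mul_nonneg (abs_nonneg (t : ℝ)) (sub_nonneg.2 ht1))]
  have e4 : C * |L| ^ 2 ≤ |L| * C * |(t : ℝ)| ^ 2 := by
    have : |L| ^ 2 ≤ |L| * |(t : ℝ)| ^ 2 := by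
      nlinarith [mul_nonneg hL (sub_nonneg.2 h1.le),
        mul_nonneg hL (sub_nonneg.2 (one_le_pow₀ ht1 : 1 ≤ |(t : ℝ)| ^ 2))]
    nlinarith
  have : (0 : ℝ) < (Qhom q u (-t) : ℤ) := by
    rw [key]
    have : 0 < (Qval q x - |L| * (B + C + 1)) * |(t : ℝ)| ^ 2 := by
      have := sub_pos.2 h2
      positivity
    nlinarith [mul_nonneg hL (sq_nonneg |(t : ℝ)|)]
  exact_mod_cast this

/-- A form that is positive at `0` and `∞` and negative at some `r/t ≤ 0` has positive middle
coefficient. -/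
lemma middle_pos {q : QF} {r t : ℤ} (ha : 0 < q.1) (hc : 0 < q.2.2) (hrt : r * t ≤ 0)
    (h : Qhom q r t < 0) : 0 < q.2.1 := by
  by_contra! hb
  have h1 := mul_nonneg_of_nonpos_of_nonpos hb hrt
  have h2 : 0 ≤ q.1 * r ^ 2 := by positivity
  have h3 : 0 ≤ q.2.2 * t ^ 2 := by positivity
  simp only [Qhom] at h
  linarith [mul_assoc q.2.1 r t]

lemma Qhom_qslash_adjugate {M : Mat2} (hM : IsUnit M.det) (q : QF) :
    Qhom (qslash M.adjugate q) (M 0 0) (M 1 0) = q.1 :=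
  congrArg Prod.fst (qslash_qslash_adjugate hM q)

lemma exists_qslash_adjugate_pos_of_small {q : QF} {x : ℝ} (hx : Irrational x)
    (hq : 0 < Qval q x) :
    ∃ e > 0, ∀ M : Mat2, IsUnit M.det →
      (|botForm M x| < e → 0 < (qslash M.adjugate q).1) ∧
      (|topForm M x| < e → 0 < (qslash M.adjugate q).2.2) := by
  obtain ⟨e, he, H⟩ := exists_Qhom_pos_of_small hq
  refine ⟨e, he, fun M hM => ⟨fun h => ?_, fun h => ?_⟩⟩
  · rw [qslash_adjugate_fst]
    exact H _ _ (botForm_ne_zero hx hM) h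
  · rw [qslash_adjugate_snd_snd]
    exact H _ _ (topForm_ne_zero hx hM) h

section RegularContinuedFraction

variable {x : ℝ}

lemma irrational_cfX (hx : Irrational x) (i : ℕ) : Irrational (cfX x i) := by
  induction i with
  | zero => exact hx
  | succ i ih =>
    rw [cfX, one_div]
    exact (ih.sub_intCast _).inv

lemma cfX_sub_floor_pos (hx : Irrational x) (i : ℕ) : 0 < cfX x i - ⌊cfX x i⌋ :=
  (Int.fract_nonneg (cfX x i)).lt_of_ne' ((irrational_cfX hx i).sub_intCast _).ne_zero

lemma one_lt_cfX_succ (hx : Irrational x) (i : ℕ) : 1 < cfX x (i + 1) := by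
  rw [cfX]
  exact (one_lt_div (cfX_sub_floor_pos hx i)).2 (Int.fract_lt_one _)

lemma one_le_cfN_succ (hx : Irrational x) (i : ℕ) : 1 ≤ cfN x (i + 1) :=
  Int.le_floor.2 (by simpa using (one_lt_cfX_succ hx i).le)

lemma isUnit_det_gam (i : ℕ) : IsUnit (gam x i).det := by
  induction i with
  | zero => simp [gam]
  | succ i ih =>
    rw [gam, Matrix.det_mul, IsUnit.mul_iff]
    exact ⟨by simp [Meps, Tpow], ih⟩

lemma gam_succ_zero (i : ℕ) (j : Fin 2) : gam x (i + 1) 0 j = gam x i 1 j := by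
  simp [gam, Meps, Tpow, Matrix.mul_apply, Fin.sum_univ_two]

lemma gam_succ_one (i : ℕ) (j : Fin 2) :
    gam x (i + 1) 1 j = gam x i 0 j - cfN x i * gam x i 1 j := by
  simp [gam, Meps, Tpow, Matrix.mul_apply, Fin.sum_univ_two]
  ring

lemma topForm_gam_succ (i : ℕ) : topForm (gam x (i + 1)) x = botForm (gam x i) x := by
  simp only [topForm, botForm, gam_succ_zero]

lemma botForm_gam_succ (i : ℕ) :
    botForm (gam x (i + 1)) x = topForm (gam x i) x - cfN x i * botForm (gam x i) x := by
  simp only [topForm, botForm, gam_succ_one]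
  push_cast
  ring

lemma topForm_gam (hx : Irrational x) (i : ℕ) :
    topForm (gam x i) x = cfX x i * botForm (gam x i) x := by
  induction i with
  | zero => simp [topForm, botForm, gam, cfX]
  | succ i ih =>
    rw [topForm_gam_succ, botForm_gam_succ, ih, cfX, cfN]
    have := (cfX_sub_floor_pos hx i).ne'
    field_simp

lemma botForm_gam_zero : botForm (gam x 0) x = 1 := by simp [botForm, gam]

lemma botForm_gam_succ_eq_mul (hx : Irrational x) (i : ℕ) :
    botForm (gam x (i + 1)) x = (cfX x i - ⌊cfX x i⌋) * botForm (gam x i) x := by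
  rw [botForm_gam_succ, topForm_gam hx, cfN]
  ring

lemma botForm_gam_pos (hx : Irrational x) (i : ℕ) : 0 < botForm (gam x i) x := by
  induction i with
  | zero => simp [botForm_gam_zero]
  | succ i ih =>
    rw [botForm_gam_succ_eq_mul hx]
    exact mul_pos (cfX_sub_floor_pos hx i) ih

lemma moeb_gam (hx : Irrational x) (i : ℕ) : moeb (gam x i) x = cfX x i := by
  rw [moeb_eq_div, topForm_gam hx, mul_div_cancel_right₀ _ (botForm_gam_pos hx i).ne']

lemma botForm_gam_add_two_le (hx : Irrational x) (i : ℕ) :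
    botForm (gam x (i + 2)) x ≤ botForm (gam x i) x - botForm (gam x (i + 1)) x := by
  rw [botForm_gam_succ, topForm_gam_succ]
  have h : (1 : ℝ) ≤ cfN x (i + 1) := by exact_mod_cast one_le_cfN_succ hx i
  nlinarith [botForm_gam_pos hx (i + 1)]

lemma botForm_gam_le_one (hx : Irrational x) (i : ℕ) : botForm (gam x i) x ≤ 1 := by
  induction i with
  | zero => simp [botForm_gam_zero]
  | succ i ih =>
    rw [botForm_gam_succ_eq_mul hx]
    exact mul_le_one₀ (Int.fract_lt_one _).le (botForm_gam_pos hx i).le ih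

lemma summable_botForm_gam (hx : Irrational x) : Summable fun i => botForm (gam x i) x := by
  refine (summable_nat_add_iff 2).1 (summable_of_sum_range_le (c := botForm (gam x 0) x)
    (fun i => (botForm_gam_pos hx _).le) fun n => ?_)
  calc ∑ i ∈ Finset.range n, botForm (gam x (i + 2)) x
      ≤ ∑ i ∈ Finset.range n, (botForm (gam x i) x - botForm (gam x (i + 1)) x) :=
        Finset.sum_le_sum fun i _ => botForm_gam_add_two_le hx i
    _ = botForm (gam x 0) x - botForm (gam x n) x := Finset.sum_range_sub' _ n
    _ ≤ botForm (gam x 0) x := sub_le_self _ (botForm_gam_pos hx n).le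

lemma summable_Qval_qslash_gam (hx : Irrational x) {m : ℕ} (hm : m ≠ 0) (q : QF) :
    Summable fun i => Qval (qslash (gam x i) q) x ^ m := by
  refine (summable_nat_add_iff 1).1 ?_
  set C : ℝ := |(q.1 : ℝ)| + |(q.2.1 : ℝ)| + |(q.2.2 : ℝ)| with hC
  refine Summable.of_norm_bounded ((summable_botForm_gam hx).mul_left (C ^ m)) fun i => ?_
  rw [Real.norm_eq_abs, abs_pow, Qval_qslash, topForm_gam_succ]
  have h0 := botForm_gam_pos hx i
  have h1 := botForm_gam_le_one hx i
  have h2 := botForm_gam_pos hx (i + 1)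
  have h3 : botForm (gam x (i + 1)) x ≤ botForm (gam x i) x := by
    rw [botForm_gam_succ_eq_mul hx]
    exact mul_le_of_le_one_left h0.le (Int.fract_lt_one _).le
  set u := botForm (gam x i) x
  set v := botForm (gam x (i + 1)) x
  have huv : |q.1 * u ^ 2 + q.2.1 * u * v + q.2.2 * v ^ 2| ≤ C * u := by
    have e1 : |(q.1 : ℝ) * u ^ 2| ≤ |(q.1 : ℝ)| * u := by
      rw [abs_mul, abs_of_nonneg (sq_nonneg u)]
      exact mul_le_mul_of_nonneg_left (by nlinarith) (abs_nonneg _)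
    have e2 : |(q.2.1 : ℝ) * u * v| ≤ |(q.2.1 : ℝ)| * u := by
      rw [mul_assoc, abs_mul, abs_of_nonneg (mul_pos h0 h2).le]
      exact mul_le_mul_of_nonneg_left (by nlinarith) (abs_nonneg _)
    have e3 : |(q.2.2 : ℝ) * v ^ 2| ≤ |(q.2.2 : ℝ)| * u := by
      rw [abs_mul, abs_of_nonneg (sq_nonneg v)]
      exact mul_le_mul_of_nonneg_left (by nlinarith) (abs_nonneg _)
    calc _ ≤ _ := abs_add_three _ _ _
      _ ≤ C * u := by rw [hC]; linarith
  calc _ ≤ (C * u) ^ m := pow_le_pow_left₀ (abs_nonneg _) huv m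
    _ = C ^ m * u ^ m := mul_pow _ _ _
    _ ≤ C ^ m * u := mul_le_mul_of_nonneg_left (pow_le_of_le_one h0.le h1 hm) (by positivity)

lemma gam_succ_entries_nonpos (hx : Irrational x) (i : ℕ) :
    gam x (i + 1) 0 0 * gam x (i + 1) 1 0 ≤ 0 := by
  induction i with
  | zero =>
    rw [gam_succ_zero]
    simp [gam]
  | succ i ih =>
    rw [gam_succ_zero, gam_succ_one (i + 1)]
    nlinarith [mul_nonneg (zero_le_one.trans (one_le_cfN_succ hx i))
      (sq_nonneg (gam x (i + 1) 1 0))]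

/-- The form `Q` transported along the continued fraction algorithm. -/
def transported (q : QF) (x : ℝ) (i : ℕ) : QF := qslash (gam x i).adjugate q

lemma transported_succ (q : QF) (i : ℕ) :
    transported q x (i + 1) =
      (QvalZ (transported q x i) (cfN x i),
        2 * (transported q x i).1 * cfN x i + (transported q x i).2.1, (transported q x i).1) := by
  rw [transported, gam, Matrix.adjugate_mul_distrib, ← qslash_qslash]
  change qslash _ (transported q x i) = _
  simp only [qslash, Qhom, QvalZ, Meps, Tpow, Matrix.adjugate_mul_distrib,
    Matrix.adjugate_fin_two_of, Matrix.mul_apply, Fin.sum_univ_two]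
  simp

lemma transported_zero (q : QF) : transported q x 0 = q := by
  simp [transported, gam, qslash, Qhom]

lemma transported_pos_of_consecutive (hx : Irrational x) {q : QF} (hq : q.1 < 0) {i : ℕ}
    (h0 : 0 < (transported q x i).1) (h1 : 0 < (transported q x (i + 1)).1) (j : ℕ) :
    0 < (transported q x (i + j)).1 ∧ 0 < (transported q x (i + j + 1)).1 := by
  induction j with
  | zero => exact ⟨h0, h1⟩
  | succ j ih =>
    obtain ⟨h0, h1⟩ := ih
    refine ⟨h1, ?_⟩
    have hc : (transported q x (i + j + 1)).2.2 = (transported q x (i + j)).1 := by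
      rw [transported_succ]
    have hb : 0 < (transported q x (i + j + 1)).2.1 := by
      refine middle_pos h1 (hc ▸ h0) (gam_succ_entries_nonpos hx (i + j)) ?_
      rw [transported, Qhom_qslash_adjugate (isUnit_det_gam _)]
      exact hq
    have hn := one_le_cfN_succ hx (i + j)
    rw [← add_assoc, transported_succ q (i + j + 1)]
    have hn0 : 0 < cfN x (i + j + 1) := hn
    exact add_pos (add_pos (mul_pos h1 (pow_pos hn0 2)) (mul_pos hb hn0)) (hc ▸ h0)

lemma eventually_transported_pos (hx : Irrational x) {q : QF} (hq : 0 < Qval q x) :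
    ∃ N, ∀ i ≥ N, 0 < (transported q x i).1 := by
  obtain ⟨e, he, H⟩ := exists_qslash_adjugate_pos_of_small hx hq
  obtain ⟨N, hN⟩ := Filter.eventually_atTop.1
    ((summable_botForm_gam hx).tendsto_atTop_zero.eventually (gt_mem_nhds he))
  refine ⟨N, fun i hi => (H _ (isUnit_det_gam i)).1 ?_⟩
  rw [abs_of_pos (botForm_gam_pos hx i)]
  exact hN i hi

end RegularContinuedFraction

lemma Qval_qslash_gam_pos {x : ℝ} (hx : Irrational x) {q : QF} (ha : 0 < q.1) (hc : q.2.2 < 0)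
    {i : ℕ} (hn : 0 < QvalZ q ⌊moeb (gam x (i + 1)) x⌋) :
    0 < Qval (qslash (gam x (i + 1)) q) x := by
  rw [moeb_gam hx] at hn
  rw [Qval_qslash, topForm_gam hx]
  have hn1 : (1 : ℝ) ≤ ⌊cfX x (i + 1)⌋ := by exact_mod_cast one_le_cfN_succ hx i
  have hy : (⌊cfX x (i + 1)⌋ : ℝ) ≤ cfX x (i + 1) := Int.floor_le _
  have hn' : (0 : ℝ) < q.1 * ⌊cfX x (i + 1)⌋ ^ 2 + q.2.1 * ⌊cfX x (i + 1)⌋ + q.2.2 := by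
    exact_mod_cast hn
  have hL := botForm_gam_pos hx (i + 1)
  have ha' : (0 : ℝ) < q.1 := by exact_mod_cast ha
  have hc' : (q.2.2 : ℝ) < 0 := by exact_mod_cast hc
  set n : ℝ := (⌊cfX x (i + 1)⌋ : ℝ)
  set y := cfX x (i + 1)
  have hlin : 0 < q.1 * n + q.2.1 := by
    by_contra! h
    nlinarith
  have hlin' : q.1 * n + q.2.1 ≤ q.1 * y + q.2.1 := by nlinarith
  have : 0 < q.1 * y ^ 2 + q.2.1 * y + q.2.2 := by
    nlinarith [mul_le_mul hy hlin' hlin.le (by linarith)]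
  have := mul_pos this (pow_pos hL 2)
  linarith [this]

lemma bijOn_SimPairs_QxSet {x : ℝ} (hx : Irrational x) {A : Set QF} (hA : IsClassQ A) :
    Set.BijOn (fun pg : QF × Mat2 => qslash pg.2 pg.1) (SimPairs A x) (QxSet A x) := by
  have pattern : ∀ {q : QF} {i : ℕ}, (q, gam x (i + 1)) ∈ SimPairs A x → ∀ {p : QF},
      qslash (gam x (i + 1)) q = p →
      q = transported p x (i + 1) ∧ (transported p x i).1 < 0 ∧
        0 < (transported p x (i + 1)).1 ∧ 0 < (transported p x (i + 2)).1 := by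
    rintro q i ⟨⟨hq, hc, ha⟩, -, hn, -⟩ p rfl
    have e : q = transported (qslash (gam x (i + 1)) q) x (i + 1) :=
      (qslash_adjugate_qslash (isUnit_det_gam _) q).symm
    simp only [moeb_gam hx] at hn hc ha
    rw [e] at hc ha hn
    refine ⟨e, ?_, ha, ?_⟩
    · rwa [transported_succ] at hc
    · rwa [transported_succ]
  refine ⟨?_, ?_, ?_⟩
  · rintro ⟨q, _⟩ ⟨⟨hq, hc, ha⟩, ⟨i, hi, rfl⟩, hn, hinf⟩
    obtain ⟨i, rfl⟩ := Nat.exists_eq_add_of_le' hi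
    exact ⟨hA.qslash_mem (isUnit_det_gam _) hq, hinf, Qval_qslash_gam_pos hx ha hc hn⟩
  · rintro ⟨q, _⟩ h ⟨q', _⟩ h' heq
    obtain ⟨i, hi, rfl⟩ := h.2.1
    obtain ⟨i', hi', rfl⟩ := h'.2.1
    obtain ⟨i, rfl⟩ := Nat.exists_eq_add_of_le' hi
    obtain ⟨i', rfl⟩ := Nat.exists_eq_add_of_le' hi'
    have hneg : (qslash (gam x (i + 1)) q).1 < 0 := h.2.2.2
    obtain ⟨e, p0, p1, p2⟩ := pattern h rfl
    obtain ⟨e', p0', p1', p2'⟩ := pattern h' heq.symm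
    have : i = i' := by
      rcases lt_trichotomy i i' with hlt | rfl | hlt
      · obtain ⟨d, rfl⟩ := Nat.exists_eq_add_of_le (Nat.succ_le_of_lt hlt)
        exact absurd (transported_pos_of_consecutive hx hneg p1 p2 d).1 p0'.not_gt
      · rfl
      · obtain ⟨d, rfl⟩ := Nat.exists_eq_add_of_le (Nat.succ_le_of_lt hlt)
        exact absurd (transported_pos_of_consecutive hx hneg p1' p2' d).1 p0.not_gt
    subst this
    rw [Prod.mk.injEq]
    exact ⟨e.trans e'.symm, rfl⟩
  · rintro p ⟨hp, hneg, hpos⟩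
    obtain ⟨N, hN⟩ := eventually_transported_pos hx hpos
    have hmem : ∀ i, transported p x i ∈ A := fun i =>
      hA.qslash_mem (isUnit_det_adjugate (isUnit_det_gam i)) hp
    obtain ⟨i, hi, hmax⟩ : ∃ i, (transported p x i).1 < 0 ∧
        ∀ j > i, 0 < (transported p x j).1 := by
      classical
      have hex : ∃ m, ∀ j ≥ m, 0 < (transported p x j).1 := ⟨N, hN⟩
      have hspec := Nat.find_spec hex
      have hne : Nat.find hex ≠ 0 := fun h0 => by
        have := hspec 0 h0.le
        rw [transported_zero] at this
        exact this.not_gt hneg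
      obtain ⟨i, hi⟩ := Nat.exists_eq_succ_of_ne_zero hne
      refine ⟨i, ?_, fun j hj => hspec j (hi ▸ hj)⟩
      have hmin := Nat.find_min hex (show i < Nat.find hex by omega)
      refine (fst_ne_zero_of_mem_Qset (hA.subset (hmem i))).lt_or_gt.resolve_right fun h => ?_
      refine hmin fun j hj => ?_
      rcases hj.eq_or_lt with rfl | hj
      · exact h
      · exact hspec j (hi ▸ hj)
    have hback : qslash (gam x (i + 1)) (transported p x (i + 1)) = p :=
      qslash_qslash_adjugate (isUnit_det_gam _) p
    refine ⟨(transported p x (i + 1), gam x (i + 1)),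
      ⟨⟨hmem _, ?_, hmax _ (by omega)⟩, ⟨i + 1, by omega, rfl⟩, ?_, ?_⟩, hback⟩
    · rwa [transported_succ]
    · have := hmax (i + 2) (by omega)
      rw [transported_succ p (i + 1)] at this
      rwa [moeb_gam hx]
    · exact (congrArg Prod.fst hback).trans_lt hneg

lemma summable_SimPairs {x : ℝ} (hx : Irrational x) {A : Set QF} (hA : IsClassQ A) {m : ℕ}
    (hm : m ≠ 0) :
    Summable fun pg : SimPairs A x => Qval (qslash pg.1.2 pg.1.1) x ^ m := by
  have : Finite (QSim A) := hA.finite_QSim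
  choose idx _ hidx using fun pg : SimPairs A x => pg.2.2.1
  have hsum : Summable fun p : QSim A × ℕ => Qval (qslash (gam x p.2) p.1) x ^ m := by
    refine summable_abs_iff.1 ((summable_prod_of_nonneg fun _ => abs_nonneg _).2
      ⟨fun q => (summable_Qval_qslash_gam hx hm q.1).abs, Summable.of_finite⟩)
  have hinj : Function.Injective fun pg : SimPairs A x =>
      ((⟨pg.1.1, pg.2.1⟩, idx pg) : QSim A × ℕ) := by
    intro a b hab
    simp only [Prod.mk.injEq, Subtype.mk.injEq] at hab
    refine Subtype.ext (Prod.ext hab.1 ?_)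
    rw [hidx a, hidx b, hab.2]
  refine (hsum.comp_injective hinj).congr fun pg => ?_
  simp only [Function.comp, ← hidx pg]

section SlowContinuedFraction

variable {x : ℝ}

/-- The invariant of the slow algorithm: before the first inversion `γ` is a translation;
afterwards both linear forms are positive and `γ(∞)` is negative. -/
def SlowInvariant (M : Mat2) (x : ℝ) : Prop :=
  IsUnit M.det ∧ 0 < botForm M x ∧
    ((M 0 0 = 1 ∧ M 1 0 = 0) ∨ (0 < topForm M x ∧ M 0 0 * M 1 0 < 0))

lemma gam'_succ_of_topForm_nonpos {i : ℕ} (hL : 0 < botForm (gam' x i) x)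
    (h : topForm (gam' x i) x ≤ 0) : gam' x (i + 1) = MT * gam' x i := by
  rw [gam', if_pos]
  rw [moeb_eq_div]
  exact div_nonpos_of_nonpos_of_nonneg h hL.le

lemma gam'_succ_of_topForm_le {i : ℕ} (hL : 0 < botForm (gam' x i) x)
    (h : 0 < topForm (gam' x i) x) (h1 : topForm (gam' x i) x ≤ botForm (gam' x i) x) :
    gam' x (i + 1) = Tpow (-1) * Meps * gam' x i := by
  rw [gam', moeb_eq_div, if_neg (div_pos h hL).not_ge, if_pos ((div_le_one hL).2 h1)]

lemma gam'_succ_of_botForm_lt {i : ℕ} (hL : 0 < botForm (gam' x i) x)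
    (h1 : botForm (gam' x i) x < topForm (gam' x i) x) :
    gam' x (i + 1) = Tpow (-1) * gam' x i := by
  rw [gam', moeb_eq_div, if_neg (div_pos (hL.trans h1) hL).not_ge,
    if_neg ((one_lt_div hL).2 h1).not_ge]

lemma topForm_MT_mul (M : Mat2) : topForm (MT * M) x = topForm M x + botForm M x := by
  simp [topForm, botForm, MT, Matrix.mul_apply, Fin.sum_univ_two]
  ring

lemma botForm_MT_mul (M : Mat2) : botForm (MT * M) x = botForm M x := by
  simp [botForm, MT, Matrix.mul_apply, Fin.sum_univ_two]

lemma topForm_Tpow_mul (M : Mat2) :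
    topForm (Tpow (-1) * M) x = topForm M x - botForm M x := by
  simp [topForm, botForm, Tpow, Matrix.mul_apply, Fin.sum_univ_two]
  ring

lemma botForm_Tpow_mul (M : Mat2) : botForm (Tpow (-1) * M) x = botForm M x := by
  simp [botForm, Tpow, Matrix.mul_apply, Fin.sum_univ_two]

lemma topForm_Tpow_mul_Meps_mul (M : Mat2) :
    topForm (Tpow (-1) * Meps * M) x = botForm M x - topForm M x := by
  simp [topForm, botForm, Tpow, Meps, Matrix.mul_apply, Fin.sum_univ_two]
  ring

lemma botForm_Tpow_mul_Meps_mul (M : Mat2) :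
    botForm (Tpow (-1) * Meps * M) x = topForm M x := by
  simp [topForm, botForm, Tpow, Meps, Matrix.mul_apply, Fin.sum_univ_two]

lemma slowInvariant_gam' (hx : Irrational x) (i : ℕ) : SlowInvariant (gam' x i) x := by
  induction i with
  | zero => exact ⟨by simp [gam'], by simp [gam', botForm], Or.inl (by simp [gam'])⟩
  | succ i ih =>
    obtain ⟨hd, hL, h⟩ := ih
    rcases le_or_gt (topForm (gam' x i) x) 0 with hK | hK
    · rw [gam'_succ_of_topForm_nonpos hL hK]
      refine ⟨?_, by rwa [botForm_MT_mul], Or.inl ?_⟩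
      · rw [Matrix.det_mul]
        exact IsUnit.mul (by simp [MT]) hd
      · obtain ⟨h0, h1⟩ := h.resolve_right fun h => h.1.not_ge hK
        simp [MT, Matrix.mul_apply, Fin.sum_univ_two, h0, h1]
    rcases le_or_gt (topForm (gam' x i) x) (botForm (gam' x i) x) with hKL | hKL
    · rw [gam'_succ_of_topForm_le hL hK hKL]
      have hd' : IsUnit (Tpow (-1) * Meps * gam' x i).det := by
        rw [Matrix.det_mul]
        exact IsUnit.mul (by simp [Tpow, Meps]) hd
      refine ⟨hd', by rwa [botForm_Tpow_mul_Meps_mul], Or.inr ⟨?_, ?_⟩⟩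
      · refine lt_of_le_of_ne' ?_ (topForm_ne_zero hx hd')
        rw [topForm_Tpow_mul_Meps_mul]
        exact sub_nonneg.2 hKL
      · have h0 : gam' x i 0 0 ≠ 0 ∧ gam' x i 0 0 * gam' x i 1 0 ≤ 0 := by
          rcases h with ⟨h0, h1⟩ | ⟨-, h⟩
          · simp [h0, h1]
          · exact ⟨left_ne_zero_of_mul h.ne, h.le⟩
        have h2 : 0 < gam' x i 0 0 ^ 2 := sq_pos_iff.2 h0.1
        simp [Tpow, Meps, Matrix.mul_apply, Fin.sum_univ_two]
        nlinarith
    · rw [gam'_succ_of_botForm_lt hL hKL]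
      refine ⟨?_, by rwa [botForm_Tpow_mul], ?_⟩
      · rw [Matrix.det_mul]
        exact IsUnit.mul (by simp [Tpow]) hd
      · refine h.imp (fun h => ?_) fun h => ⟨?_, ?_⟩
        · simp [Tpow, Matrix.mul_apply, Fin.sum_univ_two, h.1, h.2]
        · rw [topForm_Tpow_mul]
          exact sub_pos.2 hKL
        · simp [Tpow, Matrix.mul_apply, Fin.sum_univ_two]
          nlinarith [sq_nonneg (gam' x i 1 0)]

/-- The form `Q` transported along the slow continued fraction algorithm. -/
def slowTransported (q : QF) (x : ℝ) (i : ℕ) : QF := qslash (gam' x i).adjugate q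

lemma slowTransported_zero (q : QF) : slowTransported q x 0 = q := by
  simp [slowTransported, gam', qslash, Qhom]

lemma Qhom_slowTransported (hx : Irrational x) (q : QF) (i : ℕ) :
    Qhom (slowTransported q x i) (gam' x i 0 0) (gam' x i 1 0) = q.1 :=
  Qhom_qslash_adjugate (slowInvariant_gam' hx i).1 q

lemma slowInvariant_of_fst_pos (hx : Irrational x) {q : QF} (hq : q.1 < 0) {i : ℕ}
    (h : 0 < (slowTransported q x i).1) :
    0 < topForm (gam' x i) x ∧ gam' x i 0 0 * gam' x i 1 0 < 0 := by
  refine (slowInvariant_gam' hx i).2.2.resolve_left fun ⟨h0, h1⟩ => ?_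
  have := Qhom_slowTransported hx q i
  simp only [Qhom, h0, h1] at this
  linarith

lemma slowTransported_succ_of_le {q : QF} {i : ℕ} (hL : 0 < botForm (gam' x i) x)
    (h : 0 < topForm (gam' x i) x) (h1 : topForm (gam' x i) x ≤ botForm (gam' x i) x) :
    slowTransported q x (i + 1) = ((slowTransported q x i).2.2,
      (slowTransported q x i).2.1 + 2 * (slowTransported q x i).2.2,
      (slowTransported q x i).1 + (slowTransported q x i).2.1 + (slowTransported q x i).2.2) := by
  rw [slowTransported, gam'_succ_of_topForm_le hL h h1, Matrix.adjugate_mul_distrib,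
    ← qslash_qslash]
  change qslash _ (slowTransported q x i) = _
  simp only [qslash, Qhom, Meps, Tpow, Matrix.adjugate_mul_distrib,
    Matrix.adjugate_fin_two_of, Matrix.mul_apply, Fin.sum_univ_two]
  simp [mul_comm]

lemma slowTransported_succ_of_lt {q : QF} {i : ℕ} (hL : 0 < botForm (gam' x i) x)
    (h1 : botForm (gam' x i) x < topForm (gam' x i) x) :
    slowTransported q x (i + 1) = ((slowTransported q x i).1,
      2 * (slowTransported q x i).1 + (slowTransported q x i).2.1,
      (slowTransported q x i).1 + (slowTransported q x i).2.1 + (slowTransported q x i).2.2) := by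
  rw [slowTransported, gam'_succ_of_botForm_lt hL h1, Matrix.adjugate_mul_distrib,
    ← qslash_qslash]
  change qslash _ (slowTransported q x i) = _
  simp [qslash, Qhom, Tpow, Matrix.adjugate_fin_two_of]

lemma slowTransported_pos (hx : Irrational x) {q : QF} (hq : q.1 < 0) {i : ℕ}
    (ha : 0 < (slowTransported q x i).1) (hc : 0 < (slowTransported q x i).2.2) (j : ℕ) :
    0 < (slowTransported q x (i + j)).1 ∧ 0 < (slowTransported q x (i + j)).2.2 := by
  induction j with
  | zero => exact ⟨ha, hc⟩
  | succ j ih =>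
    obtain ⟨ha, hc⟩ := ih
    obtain ⟨hK, hrt⟩ := slowInvariant_of_fst_pos hx hq ha
    have hb := middle_pos ha hc hrt.le ((Qhom_slowTransported hx q (i + j)).trans_lt hq)
    have hL := (slowInvariant_gam' hx (i + j)).2.1
    rw [← add_assoc]
    rcases le_or_gt (topForm (gam' x (i + j)) x) (botForm (gam' x (i + j)) x) with h | h
    · rw [slowTransported_succ_of_le hL hK h]
      exact ⟨hc, by positivity⟩
    · rw [slowTransported_succ_of_lt hL h]
      exact ⟨ha, by positivity⟩

/-- The value at `-1` of the transported form is one of the two previous boundary values. -/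
lemma slowTransported_succ_neg_one (hx : Irrational x) {q : QF} {i : ℕ}
    (hK : 0 < topForm (gam' x i) x) :
    ((slowTransported q x (i + 1)).1 = (slowTransported q x i).2.2 ∧
      (slowTransported q x (i + 1)).1 - (slowTransported q x (i + 1)).2.1
        + (slowTransported q x (i + 1)).2.2 = (slowTransported q x i).1) ∨
    ((slowTransported q x (i + 1)).1 = (slowTransported q x i).1 ∧
      (slowTransported q x (i + 1)).1 - (slowTransported q x (i + 1)).2.1
        + (slowTransported q x (i + 1)).2.2 = (slowTransported q x i).2.2) := by
  have hL := (slowInvariant_gam' hx i).2.1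
  rcases le_or_gt (topForm (gam' x i) x) (botForm (gam' x i) x) with h | h
  · rw [slowTransported_succ_of_le hL hK h]
    exact Or.inl ⟨rfl, by ring⟩
  · rw [slowTransported_succ_of_lt hL h]
    exact Or.inr ⟨rfl, by ring⟩

lemma topForm_gam'_succ_pos (hx : Irrational x) {i : ℕ} (hK : 0 < topForm (gam' x i) x) :
    0 < topForm (gam' x (i + 1)) x := by
  have hL := (slowInvariant_gam' hx i).2.1
  refine lt_of_le_of_ne' ?_ (topForm_ne_zero hx (slowInvariant_gam' hx (i + 1)).1)
  rcases le_or_gt (topForm (gam' x i) x) (botForm (gam' x i) x) with h | h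
  · rw [gam'_succ_of_topForm_le hL hK h, topForm_Tpow_mul_Meps_mul]
    exact sub_nonneg.2 h
  · rw [gam'_succ_of_botForm_lt hL h, topForm_Tpow_mul]
    exact (sub_pos.2 h).le

lemma exists_topForm_gam'_pos (hx : Irrational x) : ∃ i, 0 < topForm (gam' x i) x := by
  by_contra! H
  have h : ∀ i : ℕ, topForm (gam' x i) x = x + i ∧ botForm (gam' x i) x = 1 := by
    intro i
    induction i with
    | zero => simp [gam', topForm, botForm]
    | succ i ih =>
      rw [gam'_succ_of_topForm_nonpos (slowInvariant_gam' hx i).2.1 (H i), topForm_MT_mul,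
        botForm_MT_mul, ih.1, ih.2]
      exact ⟨by push_cast; ring, rfl⟩
  obtain ⟨n, hn⟩ := exists_nat_gt (-x)
  have := H n
  rw [(h n).1] at this
  linarith

/-- If each step replaces a pair of positive reals by their minimum and their difference, as in
the subtractive Euclidean algorithm, then both members of the pair become arbitrarily small. -/
lemma exists_max_lt_of_subtractive {K L : ℕ → ℝ} (hK : ∀ i, 0 < K i) (hL : ∀ i, 0 < L i)
    (hmax : ∀ i, K (i + 1) + L (i + 1) = max (K i) (L i))
    (hmin : ∀ i, min (K (i + 1)) (L (i + 1)) =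
      min (max (K i) (L i) - min (K i) (L i)) (min (K i) (L i))) {e : ℝ} (he : 0 < e) :
    ∃ i, max (K i) (L i) < e := by
  by_contra! H
  have hdec : ∀ i, K (i + 1) + L (i + 1) = K i + L i - min (K i) (L i) := fun i => by
    rw [hmax, ← max_add_min (K i) (L i)]
    ring
  have hpos : ∀ i, 0 < min (K i) (L i) := fun i => lt_min (hK i) (hL i)
  have hsum : Summable fun i => min (K i) (L i) := by
    refine summable_of_sum_range_le (c := K 0 + L 0) (fun i => (hpos i).le) fun n => ?_
    have : ∑ i ∈ Finset.range n, min (K i) (L i) = (K 0 + L 0) - (K n + L n) := by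
      rw [← Finset.sum_range_sub' (fun i => K i + L i) n]
      exact Finset.sum_congr rfl fun i _ => by rw [hdec]; ring
    rw [this]
    linarith [hK n, hL n]
  obtain ⟨N, hN⟩ := Filter.eventually_atTop.1
    (hsum.tendsto_atTop_zero.eventually (gt_mem_nhds (half_pos he)))
  have hconst : ∀ j, min (K (N + j)) (L (N + j)) = min (K N) (L N) := by
    intro j
    induction j with
    | zero => rfl
    | succ j ih =>
      rw [← ih, ← add_assoc, hmin]
      have h1 := hN (N + j) (by omega)
      have h2 := H (N + j)
      exact min_eq_right (by linarith)
  obtain ⟨N', hN'⟩ := Filter.eventually_atTop.1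
    (hsum.tendsto_atTop_zero.eventually (gt_mem_nhds (hpos N)))
  exact (hN' (N + N') (by omega)).ne (hconst N')

lemma exists_forms_lt (hx : Irrational x) {e : ℝ} (he : 0 < e) :
    ∃ i, 0 < topForm (gam' x i) x ∧ topForm (gam' x i) x < e ∧ botForm (gam' x i) x < e := by
  obtain ⟨n, hn⟩ := exists_topForm_gam'_pos hx
  have hK : ∀ i, 0 < topForm (gam' x (n + i)) x := by
    intro i
    induction i with
    | zero => exact hn
    | succ i ih => exact topForm_gam'_succ_pos hx ih
  have hL : ∀ i, 0 < botForm (gam' x (n + i)) x := fun i => (slowInvariant_gam' hx _).2.1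
  obtain ⟨i, hi⟩ : ∃ i, max (topForm (gam' x (n + i)) x) (botForm (gam' x (n + i)) x) < e := by
    refine exists_max_lt_of_subtractive hK hL (fun i => ?_) (fun i => ?_) he
    · rw [← add_assoc]
      rcases le_or_gt (topForm (gam' x (n + i)) x) (botForm (gam' x (n + i)) x) with h | h
      · rw [gam'_succ_of_topForm_le (hL i) (hK i) h, topForm_Tpow_mul_Meps_mul,
          botForm_Tpow_mul_Meps_mul, max_eq_right h, sub_add_cancel]
      · rw [gam'_succ_of_botForm_lt (hL i) h, topForm_Tpow_mul, botForm_Tpow_mul,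
          max_eq_left h.le, sub_add_cancel]
    · rw [← add_assoc]
      rcases le_or_gt (topForm (gam' x (n + i)) x) (botForm (gam' x (n + i)) x) with h | h
      · rw [gam'_succ_of_topForm_le (hL i) (hK i) h, topForm_Tpow_mul_Meps_mul,
          botForm_Tpow_mul_Meps_mul, max_eq_right h, min_eq_left h]
      · rw [gam'_succ_of_botForm_lt (hL i) h, topForm_Tpow_mul, botForm_Tpow_mul,
          max_eq_left h.le, min_eq_right h.le]
  exact ⟨n + i, hK i, max_lt_iff.1 hi⟩

lemma exists_slowTransported_pos (hx : Irrational x) {q : QF} (hq : 0 < Qval q x) :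
    ∃ i, 0 < (slowTransported q x i).1 ∧ 0 < (slowTransported q x i).2.2 := by
  obtain ⟨e, he, H⟩ := exists_qslash_adjugate_pos_of_small hx hq
  obtain ⟨i, hK, hKe, hLe⟩ := exists_forms_lt hx he
  obtain ⟨hd, hL, -⟩ := slowInvariant_gam' hx i
  exact ⟨i, (H _ hd).1 (by rwa [abs_of_pos hL]), (H _ hd).2 (by rwa [abs_of_pos hK])⟩

end SlowContinuedFraction

lemma Qval_qslash_gam'_pos {x : ℝ} (hx : Irrational x) {q : QF} (ha : 0 < q.1)
    (hb : q.1 - q.2.1 + q.2.2 < 0) (hc : 0 < q.2.2) {i : ℕ}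
    (hinf : Qhom q (gam' x i 0 0) (gam' x i 1 0) < 0) :
    0 < Qval (qslash (gam' x i) q) x := by
  obtain ⟨-, hL, h⟩ := slowInvariant_gam' hx i
  obtain ⟨hK, -⟩ := h.resolve_left fun ⟨h0, h1⟩ => by
    simp only [Qhom, h0, h1] at hinf
    linarith
  have hb' : 0 < q.2.1 := by linarith
  have ha' : (0 : ℝ) < q.1 := by exact_mod_cast ha
  have hb'' : (0 : ℝ) < q.2.1 := by exact_mod_cast hb'
  have hc' : (0 : ℝ) < q.2.2 := by exact_mod_cast hc
  rw [Qval_qslash]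
  positivity

lemma bijOn_RedPairs_QxSet {x : ℝ} (hx : Irrational x) {A : Set QF} (hA : IsClassQ A) :
    Set.BijOn (fun pg : QF × Mat2 => qslash pg.2 pg.1) (RedPairs A x) (QxSet A x) := by
  have hdet : ∀ i, IsUnit (gam' x i).det := fun i => (slowInvariant_gam' hx i).1
  have pattern : ∀ {q : QF} {i : ℕ}, (q, gam' x (i + 1)) ∈ RedPairs A x → ∀ {p : QF},
      qslash (gam' x (i + 1)) q = p → q = slowTransported p x (i + 1) := by
    rintro q i - p rfl
    exact (qslash_adjugate_qslash (hdet _) q).symm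
  have separate : ∀ {p q q' : QF} {i i' : ℕ}, (q, gam' x (i + 1)) ∈ RedPairs A x →
      (q', gam' x (i' + 1)) ∈ RedPairs A x → qslash (gam' x (i + 1)) q = p →
      qslash (gam' x (i' + 1)) q' = p → ¬ i < i' := by
    intro p q q' i i' h h' hp hp' hlt
    have hneg : p.1 < 0 := hp ▸ h.2.2
    have e := pattern h hp
    have e' := pattern h' hp'
    obtain ⟨d, rfl⟩ := Nat.exists_eq_add_of_le (Nat.succ_le_of_lt hlt)
    obtain ⟨ha, hc⟩ := slowTransported_pos hx hneg (e ▸ h.1.2.1) (e ▸ h.1.2.2.2) d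
    have hm : q'.1 - q'.2.1 + q'.2.2 < 0 := h'.1.2.2.1
    rw [e'] at hm
    rcases slowTransported_succ_neg_one hx (q := p)
      (slowInvariant_of_fst_pos hx hneg ha).1 with ⟨-, h1⟩ | ⟨-, h1⟩
    · exact absurd (h1 ▸ hm) ha.not_gt
    · exact absurd (h1 ▸ hm) hc.not_gt
  refine ⟨?_, ?_, ?_⟩
  · rintro ⟨q, _⟩ ⟨⟨hq, ha, hb, hc⟩, ⟨i, -, rfl⟩, hinf⟩
    exact ⟨hA.qslash_mem (hdet i) hq, hinf, Qval_qslash_gam'_pos hx ha hb hc hinf⟩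
  · rintro ⟨q, _⟩ h ⟨q', _⟩ h' heq
    obtain ⟨i, hi, rfl⟩ := h.2.1
    obtain ⟨i', hi', rfl⟩ := h'.2.1
    obtain ⟨i, rfl⟩ := Nat.exists_eq_add_of_le' hi
    obtain ⟨i', rfl⟩ := Nat.exists_eq_add_of_le' hi'
    obtain rfl : i = i' := le_antisymm (not_lt.1 (separate h' h heq.symm rfl))
      (not_lt.1 (separate h h' rfl heq.symm))
    rw [Prod.mk.injEq]
    exact ⟨(pattern h rfl).trans (pattern h' heq.symm).symm, rfl⟩
  · rintro p ⟨hp, hneg, hpos⟩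
    have hmem : ∀ i, slowTransported p x i ∈ A := fun i =>
      hA.qslash_mem (isUnit_det_adjugate (hdet i)) hp
    classical
    have hex := exists_slowTransported_pos hx hpos
    obtain ⟨ha, hc⟩ := Nat.find_spec hex
    have hne : Nat.find hex ≠ 0 := fun h0 => by
      rw [h0, slowTransported_zero] at ha
      exact ha.not_gt hneg
    obtain ⟨i, hi⟩ := Nat.exists_eq_succ_of_ne_zero hne
    have hmin := Nat.find_min hex (show i < Nat.find hex by omega)
    rw [hi] at ha hc
    have ha0 := fst_ne_zero_of_mem_Qset (hA.subset (hmem i))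
    have hc0 := snd_snd_ne_zero_of_mem_Qset (hA.subset (hmem i))
    have hback : qslash (gam' x (i + 1)) (slowTransported p x (i + 1)) = p :=
      qslash_qslash_adjugate (hdet _) p
    have hK : 0 < topForm (gam' x i) x := by
      by_contra! hK
      have hrt := (slowInvariant_of_fst_pos hx hneg ha).2
      obtain ⟨-, hL, h⟩ := slowInvariant_gam' hx i
      rw [Nat.succ_eq_add_one, gam'_succ_of_topForm_nonpos hL hK] at hrt
      obtain ⟨h0, h1⟩ := h.resolve_right fun h => h.1.not_ge hK
      simp [MT, Matrix.mul_apply, Fin.sum_univ_two, h0, h1] at hrt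
    refine ⟨(slowTransported p x (i + 1), gam' x (i + 1)),
      ⟨⟨hmem _, ha, ?_, hc⟩, ⟨i + 1, by omega, rfl⟩, (congrArg Prod.fst hback).trans_lt hneg⟩,
      hback⟩
    simp only [Nat.succ_eq_add_one] at ha hc
    rcases slowTransported_succ_neg_one hx (q := p) hK with ⟨h0, h1⟩ | ⟨h0, h1⟩
    · rw [h1]
      exact ha0.lt_or_gt.resolve_right fun h => hmin ⟨h, h0 ▸ ha⟩
    · rw [h1]
      exact hc0.lt_or_gt.resolve_right fun h => hmin ⟨h0 ▸ ha, h⟩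

lemma Set.BijOn.summable_iff_and_tsum_eq {α β : Type*} {g : α → β} {s : Set α} {t : Set β}
    (h : Set.BijOn g s t) (f : β → ℝ) :
    ((Summable fun a : s => f (g a)) ↔ Summable fun b : t => f b) ∧
      ∑' b : t, f b = ∑' a : s, f (g a) :=
  ⟨(h.equiv g).summable_iff (f := fun b : t => f b),
    ((h.equiv g).tsum_eq (fun b : t => f b)).symm⟩

/-- **Corollary of Theorems 3 and 4.** For irrational `x`, `k ≥ 2` and a
`Γ`-equivalence class `A` in `𝒬`:
`A_{k,A}(x) = ∑_{Q ∈ A^Sim} ∑_{γ ∈ Γ(x), Q(⌊γ(x)⌋)>0, Q(γ(∞))<0} (Q|γ)(x)^{k-1}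
           = ∑_{Q ∈ A^Red} ∑_{γ ∈ Γ(x)', Q(γ(∞))<0} (Q|γ)(x)^{k-1}`. -/
theorem stmt9 (x : ℝ) (hx : Irrational x) (k : ℕ) (hk : 2 ≤ k)
    (A : Set QF) (hA : IsClassQ A) :
    Summable (fun q : ↥(QxSet A x) => Qval q.1 x ^ (k - 1)) ∧
    Summable (fun pg : ↥(SimPairs A x) => Qval (qslash pg.1.2 pg.1.1) x ^ (k - 1)) ∧
    Summable (fun pg : ↥(RedPairs A x) => Qval (qslash pg.1.2 pg.1.1) x ^ (k - 1)) ∧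
    (∑' q : ↥(QxSet A x), Qval q.1 x ^ (k - 1)) =
      (∑' pg : ↥(SimPairs A x), Qval (qslash pg.1.2 pg.1.1) x ^ (k - 1)) ∧
    (∑' q : ↥(QxSet A x), Qval q.1 x ^ (k - 1)) =
      (∑' pg : ↥(RedPairs A x), Qval (qslash pg.1.2 pg.1.1) x ^ (k - 1)) := by
  have hm : k - 1 ≠ 0 := by omega
  obtain ⟨hS, hS'⟩ :=
    (bijOn_SimPairs_QxSet hx hA).summable_iff_and_tsum_eq fun q => Qval q x ^ (k - 1)
  obtain ⟨hR, hR'⟩ :=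
    (bijOn_RedPairs_QxSet hx hA).summable_iff_and_tsum_eq fun q => Qval q x ^ (k - 1)
  have hsum := summable_SimPairs hx hA hm
  exact ⟨hS.1 hsum, hsum, hR.2 (hS.1 hsum), hS', hR'⟩
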